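/- Let F be an algebraically closed field and let k be a field extension of F of transcendence degree one over F. Let σ be an involution of k that restricts to the identity on F, and assume that either σ is not the identity or the characteristic of k is not 2. Let V be a finite-dimensional k-vector space of dimension at least 3, and let B be a hermitian form on V (with respect to σ). Then V contains a nonzero isotropic vector, i.e. there exists v ∈ V with v ≠ 0 and B(v,v) = 0. -/

import Mathlib

theorem tsenaux_height {F ι : Type*} [Field F] [IsAlgClosed F] [Finite ι] :
    (Nat.card ι : ℕ∞) ≤ (MvPolynomial.vanishingIdeal F {(0 : ι → F)}).height := by
  have h1 : ringKrullDim (MvPolynomial ι F) = Nat.card ι := by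
    rw [MvPolynomial.ringKrullDim_of_isNoetherianRing]; simp
  have h2 : ringKrullDim (MvPolynomial ι F) ≤
      ((MvPolynomial.vanishingIdeal F {(0 : ι → F)}).height : WithBot ℕ∞) := by
    rw [ringKrullDim_le_iff_isMaximal_height_le]
    intro M hM
    obtain ⟨x, rfl⟩ := MvPolynomial.isMaximal_iff_eq_vanishingIdeal_singleton.1 hM
    let f : MvPolynomial ι F →ₐ[F] MvPolynomial ι F :=
      MvPolynomial.aeval (fun i => MvPolynomial.X i + MvPolynomial.C (x i))
    let g : MvPolynomial ι F →ₐ[F] MvPolynomial ι F :=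
      MvPolynomial.aeval (fun i => MvPolynomial.X i - MvPolynomial.C (x i))
    let e : MvPolynomial ι F ≃ₐ[F] MvPolynomial ι F := AlgEquiv.ofAlgHom f g
      (by ext i : 1; simp [f, g, MvPolynomial.algHom_C])
      (by ext i : 1; simp [f, g, MvPolynomial.algHom_C])
    have : MvPolynomial.vanishingIdeal F {x} =
        (MvPolynomial.vanishingIdeal F {(0 : ι → F)}).comap e.toRingEquiv := by
      ext p
      have h : (MvPolynomial.aeval (0 : ι → F)).comp f = MvPolynomial.aeval x := by
        ext i; simp [f]
      have := DFunLike.congr_fun h p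
      simp only [Ideal.mem_comap, MvPolynomial.mem_vanishingIdeal_singleton_iff]
      rw [← this]; rfl
    rw [this, RingEquiv.height_comap]
  rw [h1] at h2
  exact_mod_cast h2

theorem tsenaux_zero {F ι κ : Type*} [Field F] [IsAlgClosed F] [Fintype ι] [Fintype κ]
    (hc : Fintype.card κ < Fintype.card ι) (f : κ → MvPolynomial ι F)
    (hf : ∀ j, MvPolynomial.aeval (0 : ι → F) (f j) = 0) :
    ∃ y : ι → F, y ≠ 0 ∧ ∀ j, MvPolynomial.aeval y (f j) = 0 := by
  classical
  by_contra! hcon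
  let M := MvPolynomial.vanishingIdeal F {(0 : ι → F)}
  let s : Finset (MvPolynomial ι F) := Finset.univ.image f
  have hle : Ideal.span (s : Set (MvPolynomial ι F)) ≤ M := by
    rw [Ideal.span_le]
    intro p hp
    simp only [s, Finset.coe_image, Finset.coe_univ, Set.image_univ, Set.mem_range] at hp
    obtain ⟨j, rfl⟩ := hp
    exact (MvPolynomial.mem_vanishingIdeal_singleton_iff _ _).2 (hf j)
  have hmin : M ∈ (Ideal.span (s : Set (MvPolynomial ι F))).minimalPrimes := by
    refine ⟨⟨inferInstance, hle⟩, ?_⟩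
    rintro Q ⟨hQ, hQs⟩ -
    have : Q = MvPolynomial.vanishingIdeal F (MvPolynomial.zeroLocus F Q) :=
      (MvPolynomial.IsPrime.vanishingIdeal_zeroLocus Q).symm
    rw [this]
    apply MvPolynomial.vanishingIdeal_anti_mono
    intro y hy
    by_contra hy0
    obtain ⟨j, hj⟩ := hcon y hy0
    exact hj (hy _ (hQs (Ideal.subset_span (by simp [s]))))
  have h1 := Ideal.height_le_card_of_mem_minimalPrimes_span_finset hmin
  have h2 := (tsenaux_height (F := F) (ι := ι)).trans h1
  have h3 : s.card ≤ Fintype.card κ := Finset.card_image_le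
  rw [Nat.card_eq_fintype_card] at h2
  have h4 : Fintype.card ι ≤ s.card := by exact_mod_cast h2
  omega

open Polynomial in
theorem tsenaux_poly {F I M : Type*} [Field F] [IsAlgClosed F] [Fintype I] [Fintype M]
    (hc : 2 * Fintype.card M < Fintype.card I) (C : I → I → M → F[X]) :
    ∃ P : I → F[X], P ≠ 0 ∧ ∀ m, ∑ i, ∑ j, C i j m * P i * P j = 0 := by
  classical
  obtain ⟨c, hcb⟩ : ∃ c : ℕ, ∀ i j m, (C i j m).natDegree ≤ c := by
    refine ⟨Finset.univ.sup fun q : I × I × M => (C q.1 q.2.1 q.2.2).natDegree, ?_⟩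
    intro i j m
    exact Finset.le_sup (f := fun q : I × I × M => (C q.1 q.2.1 q.2.2).natDegree)
      (Finset.mem_univ (i, j, m))
  let s := Fintype.card M * (c + 1)
  let R := MvPolynomial (I × Fin (s + 1)) F
  let G : I → R[X] := fun i => ∑ a : Fin (s + 1),
    Polynomial.C (MvPolynomial.X (i, a) : R) * X ^ (a : ℕ)
  let H : M → R[X] := fun m => ∑ i, ∑ j, (C i j m).map (algebraMap F R) * G i * G j
  let P : (I × Fin (s + 1) → F) → I → F[X] := fun y i =>
    ∑ a : Fin (s + 1), Polynomial.C (y (i, a)) * X ^ (a : ℕ)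
  have hG : ∀ y i, (G i).map (MvPolynomial.aeval y : R →ₐ[F] F).toRingHom = P y i := by
    intro y i
    simp [G, P, Polynomial.map_sum]
  have hmC : ∀ y (p : F[X]), (p.map (algebraMap F R)).map
      (MvPolynomial.aeval y : R →ₐ[F] F).toRingHom = p := by
    intro y p
    rw [Polynomial.map_map]
    convert Polynomial.map_id
    ext x
    simp [R]
  have hH : ∀ y m, (H m).map (MvPolynomial.aeval y : R →ₐ[F] F).toRingHom =
      ∑ i, ∑ j, C i j m * P y i * P y j := by
    intro y m
    simp only [H, Polynomial.map_sum, Polynomial.map_mul, hG, hmC]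
  have hPdeg : ∀ y i, (P y i).natDegree ≤ s := by
    intro y i
    refine Polynomial.natDegree_sum_le_of_forall_le _ _ fun a _ => ?_
    exact (Polynomial.natDegree_C_mul_X_pow_le _ _).trans (by omega)
  have hdeg : ∀ y m, (∑ i, ∑ j, C i j m * P y i * P y j).natDegree ≤ c + s + s := by
    intro y m
    refine Polynomial.natDegree_sum_le_of_forall_le _ _ fun i _ =>
      Polynomial.natDegree_sum_le_of_forall_le _ _ fun j _ => ?_
    exact Polynomial.natDegree_mul_le_of_le
      (Polynomial.natDegree_mul_le_of_le (hcb _ _ _) (hPdeg _ _)) (hPdeg _ _)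
  have key : ∀ y m e, MvPolynomial.aeval y ((H m).coeff e) =
      (∑ i, ∑ j, C i j m * P y i * P y j).coeff e := by
    intro y m e
    rw [← hH, Polynomial.coeff_map]; rfl
  obtain ⟨y, hy0, hy⟩ := tsenaux_zero (F := F) (ι := I × Fin (s + 1))
    (κ := M × Fin (c + s + s + 1)) (by
      simp only [Fintype.card_prod, Fintype.card_fin]
      have : (2 * Fintype.card M + 1) * (s + 1) ≤ Fintype.card I * (s + 1) :=
        Nat.mul_le_mul_right _ hc
      have hs : s = Fintype.card M * (c + 1) := rfl
      nlinarith) (fun q => (H q.1).coeff q.2) (by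
      rintro ⟨m, e⟩
      rw [key]
      simp [P])
  refine ⟨P y, ?_, ?_⟩
  · intro h
    apply hy0
    ext ⟨i, a⟩
    have := congrArg (fun p => p.coeff (a : ℕ)) (congrFun h i)
    simpa [P, Polynomial.finsetSum_coeff, Polynomial.coeff_C_mul, Polynomial.coeff_X_pow,
      Fin.val_inj] using this
  · intro m
    ext e
    by_cases he : e < c + s + s + 1
    · rw [← key]
      simpa using hy (m, ⟨e, he⟩)
    · rw [Polynomial.coeff_zero]
      exact Polynomial.coeff_eq_zero_of_natDegree_lt ((hdeg y m).trans_lt (by omega))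

open Polynomial in
theorem tsenaux_field {F k : Type*} [Field F] [IsAlgClosed F] [Field k] [Algebra F[X] k]
    [Algebra (FractionRing F[X]) k] [IsScalarTower F[X] (FractionRing F[X]) k]
    [Algebra.IsAlgebraic (FractionRing F[X]) k] (σ : k →+* k)
    (hσ : ∀ p : F[X], σ (algebraMap F[X] k p) = algebraMap F[X] k p)
    (b : Fin 3 → Fin 3 → k) (hb : ∀ i j, σ (b i j) = b j i) :
    ∃ x : Fin 3 → k, x ≠ 0 ∧ ∑ i, ∑ j, x i * σ (x j) * b i j = 0 := by
  let L := FractionRing F[X]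
  have hσL : ∀ r : L, σ (algebraMap L k r) = algebraMap L k r := by
    have : σ.comp (algebraMap L k) = algebraMap L k := by
      apply IsLocalization.ringHom_ext (nonZeroDivisors F[X])
      ext p
      · simp [← IsScalarTower.algebraMap_apply, L, hσ]
      · simp [← IsScalarTower.algebraMap_apply, L, hσ]
    exact fun r => RingHom.congr_fun this r
  let τ : k →ₐ[L] k := { σ with commutes' := hσL }
  let S : Set k := Set.range fun q : Fin 3 × Fin 3 => b q.1 q.2
  let K : IntermediateField L k := IntermediateField.adjoin L S
  have hbK : ∀ i j, b i j ∈ K := fun i j => IntermediateField.subset_adjoin _ _ ⟨(i, j), rfl⟩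
  have hfin : FiniteDimensional L K := by
    apply IntermediateField.finiteDimensional_adjoin
    · intro x _; exact (Algebra.IsAlgebraic.isAlgebraic x).isIntegral
  have hKσ : ∀ x ∈ K, σ x ∈ K := by
    have : K ≤ K.comap τ := by
      rw [IntermediateField.adjoin_le_iff]
      rintro _ ⟨⟨i, j⟩, rfl⟩
      change σ (b i j) ∈ K
      rw [hb]; exact hbK _ _
    exact fun x hx => this hx
  let n := Module.finrank L K
  have hn : 0 < n := Module.finrank_pos
  let ω : Module.Basis (Fin n) L K := Module.finBasis L K
  let I := Fin 3 × Fin n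
  let z : I → I → K := fun q r => ⟨ω q.2 * σ (ω r.2) * b q.1 r.1,
    K.mul_mem (K.mul_mem (ω q.2).2 (hKσ _ (ω r.2).2)) (hbK _ _)⟩
  obtain ⟨d, hd⟩ := IsLocalization.exist_integer_multiples_of_finite (nonZeroDivisors F[X])
    (fun q : I × I × Fin n => (ω.repr (z q.1 q.2.1) q.2.2 : L))
  choose C hC using hd
  obtain ⟨P, hP0, hP⟩ := tsenaux_poly (F := F) (I := I) (M := Fin n)
    (by simp [I]; omega) (fun q r m => C (q, r, m))
  have hz : ∀ q r, algebraMap F[X] k d * (z q r : k) =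
      ∑ m, algebraMap F[X] k (C (q, r, m)) * (ω m : k) := by
    intro q r
    have h := congrArg (algebraMap K k) (ω.sum_repr (z q r))
    rw [map_sum] at h
    have h' : (z q r : k) = ∑ m, algebraMap L k (ω.repr (z q r) m) * (ω m : k) := by
      rw [show (z q r : k) = algebraMap K k (z q r) from rfl, ← h]
      refine Finset.sum_congr rfl fun m _ => ?_
      rw [Algebra.smul_def, map_mul]; rfl
    rw [h', Finset.mul_sum]
    refine Finset.sum_congr rfl fun m _ => ?_
    rw [← mul_assoc]
    congr 1
    rw [IsScalarTower.algebraMap_apply F[X] L k, IsScalarTower.algebraMap_apply F[X] L k, hC,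
      Algebra.smul_def, map_mul]
  let x : Fin 3 → k := fun i => ∑ m, algebraMap F[X] k (P (i, m)) * (ω m : k)
  have hinj : Function.Injective (algebraMap F[X] k) := by
    rw [IsScalarTower.algebraMap_eq F[X] L k]
    exact (algebraMap L k).injective.comp (IsFractionRing.injective F[X] L)
  refine ⟨x, ?_, ?_⟩
  · intro hx
    apply hP0
    ext1 ⟨i, m⟩
    have h1 : ∑ m, algebraMap F[X] L (P (i, m)) • ω m = 0 := by
      apply (algebraMap K k).injective
      rw [map_sum, map_zero]
      refine Eq.trans ?_ (congrFun hx i)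
      refine Finset.sum_congr rfl fun m _ => ?_
      rw [Algebra.smul_def, map_mul, IsScalarTower.algebraMap_apply F[X] L k]; rfl
    have h2 := Fintype.linearIndependent_iff.1 ω.linearIndependent _ h1 m
    exact IsFractionRing.injective F[X] L (by rw [h2]; simp)
  · have hd0 : algebraMap F[X] k d ≠ 0 := by
      rw [Ne, map_eq_zero_iff _ hinj]; exact nonZeroDivisors.coe_ne_zero d
    refine (mul_eq_zero.1 ?_).resolve_left hd0
    have e1 : ∑ i, ∑ j, x i * σ (x j) * b i j =
        ∑ q : I, ∑ r : I, algebraMap F[X] k (P q * P r) * (z q r : k) := by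
      have e0 : ∀ i j, x i * σ (x j) * b i j = ∑ m, ∑ m',
          algebraMap F[X] k (P (i, m) * P (j, m')) * (z (i, m) (j, m') : k) := by
        intro i j
        simp only [x, z, map_sum, map_mul, hσ]
        rw [Finset.sum_mul_sum, Finset.sum_mul]
        refine Finset.sum_congr rfl fun m _ => ?_
        rw [Finset.sum_mul]
        refine Finset.sum_congr rfl fun m' _ => ?_
        ring
      simp only [I, Fintype.sum_prod_type, e0]
      refine Finset.sum_congr rfl fun i _ => ?_
      exact Finset.sum_comm
    rw [e1, Finset.mul_sum]
    have e2 : ∀ q : I, algebraMap F[X] k d * ∑ r : I, algebraMap F[X] k (P q * P r) * (z q r : k)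
        = ∑ m, algebraMap F[X] k (∑ r, C (q, r, m) * P q * P r) * (ω m : k) := by
      intro q
      simp only [map_sum, Finset.sum_mul]
      rw [Finset.mul_sum, Finset.sum_comm]
      refine Finset.sum_congr rfl fun r _ => ?_
      rw [mul_left_comm, hz, Finset.mul_sum]
      refine Finset.sum_congr rfl fun m _ => ?_
      simp only [map_mul]; ring
    simp only [e2]
    rw [Finset.sum_comm]
    refine Finset.sum_eq_zero fun m _ => ?_
    rw [← Finset.sum_mul, ← map_sum, hP]; simp

theorem hermitian_exists_isotropic_of_trdeg_one_over_algClosed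
    {F k V : Type*} [Field F] [IsAlgClosed F] [Field k] [Algebra F k]
    (htr : ∃ x : k, IsTranscendenceBasis F (fun _ : Unit => x))
    [AddCommGroup V] [Module k V]
    [FiniteDimensional k V] (hdim : 3 ≤ Module.finrank k V)
    (σ : k →+* k) (hσ : Function.Involutive σ)
    (hfixF : ∀ a : F, σ (algebraMap F k a) = algebraMap F k a)
    (hkey : (∃ x : k, σ x ≠ x) ∨ (2 : k) ≠ 0)
    (B : V →ₗ[k] V →ₛₗ[σ] k)
    (hherm : ∀ v w : V, σ (B v w) = B w v) :
    ∃ v : V, v ≠ 0 ∧ B v v = 0 := by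
  obtain ⟨x, hx⟩ := htr
  have hxt : Transcendental F x := by
    have := hx.1.transcendental ()
    exact this
  -- a transcendental element fixed by the involution
  obtain ⟨t, ht, htσ⟩ : ∃ t : k, Transcendental F t ∧ σ t = t := by
    by_contra! hcon
    have h1 : IsAlgebraic F (x + σ x) := by
      by_contra h
      exact hcon _ h (by rw [map_add, hσ x, add_comm])
    have h2 : IsAlgebraic F (x * σ x) := by
      by_contra h
      exact hcon _ h (by rw [map_mul, hσ x, mul_comm])
    have hr : ∀ u : k, IsAlgebraic F u → ∃ a : F, algebraMap F k a = u := fun u hu =>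
      minpoly.mem_range_of_degree_eq_one F u
        (IsAlgClosed.degree_eq_one_of_irreducible F (minpoly.irreducible hu.isIntegral))
    obtain ⟨a, ha⟩ := hr _ h1
    obtain ⟨c, hc⟩ := hr _ h2
    apply hxt
    refine ⟨Polynomial.X ^ 2 - Polynomial.C a * Polynomial.X + Polynomial.C c, ?_, ?_⟩
    · intro h
      have := congrArg (fun p => Polynomial.coeff p 2) h
      simp at this
    · simp [ha, hc]
      ring
  have htr1 : Cardinal.lift (Algebra.trdeg F k) = 1 := by
    rw [← hx.lift_cardinalMk_eq_trdeg]; simp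
  let : Algebra (Polynomial F) k := (Polynomial.aeval t).toAlgebra
  have hdef : ∀ p : Polynomial F, algebraMap (Polynomial F) k p = Polynomial.aeval t p :=
    fun _ => rfl
  have : IsScalarTower F (Polynomial F) k := IsScalarTower.of_algebraMap_eq fun a => by
    simp [hdef]
  have hinj : Function.Injective (algebraMap (Polynomial F) k) :=
    transcendental_iff_injective.1 ht
  have : FaithfulSMul (Polynomial F) k := (faithfulSMul_iff_algebraMap_injective _ _).2 hinj
  have hadd := lift_trdeg_add_eq F (Polynomial F) k
  have halg : Algebra.IsAlgebraic (Polynomial F) k := by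
    rw [← trdeg_eq_zero_iff]
    have hX : Algebra.trdeg F (Polynomial F) = 1 := by simp
    have hk : Algebra.trdeg F k = 1 := by simpa using htr1
    rw [hX, hk] at hadd
    simp only [Cardinal.lift_one] at hadd
    have hlt : Algebra.trdeg (Polynomial F) k < Cardinal.aleph0 := by
      rw [← Cardinal.lift_lt_aleph0, ← Cardinal.lift_id (Cardinal.lift _)]
      refine lt_of_le_of_lt ?_ Cardinal.one_lt_aleph0
      rw [Cardinal.lift_id, ← hadd]
      exact le_add_self
    obtain ⟨n, hn⟩ := Cardinal.lt_aleph0.1 hlt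
    rw [hn] at hadd ⊢
    simp only [Cardinal.lift_natCast] at hadd
    have : 1 + n = 1 := by exact_mod_cast hadd
    have : n = 0 := by omega
    simp [this]
  let : Algebra (FractionRing (Polynomial F)) k := FractionRing.liftAlgebra _ _
  have : IsScalarTower (Polynomial F) (FractionRing (Polynomial F)) k :=
    inferInstance
  have : Algebra.IsAlgebraic (FractionRing (Polynomial F)) k :=
    (IsFractionRing.comap_isAlgebraic_iff (A := Polynomial F)).1 halg
  have hσp : ∀ p : Polynomial F,
      σ (algebraMap (Polynomial F) k p) = algebraMap (Polynomial F) k p := by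
    intro p
    let τ : k →ₐ[F] k := { σ with commutes' := hfixF }
    rw [hdef]
    have := Polynomial.aeval_algHom_apply τ t p
    have h2 : τ t = t := htσ
    rw [h2] at this
    exact this.symm
  obtain ⟨e, he⟩ : ∃ e : Fin 3 → V, LinearIndependent k e := by
    let b := Module.finBasis k V
    exact ⟨fun i => b (Fin.castLE hdim i),
      b.linearIndependent.comp _ (Fin.castLE_injective hdim)⟩
  obtain ⟨y, hy0, hy⟩ := tsenaux_field σ hσp (fun i j => B (e i) (e j)) (fun i j => hherm _ _)
  refine ⟨∑ i, y i • e i, ?_, ?_⟩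
  · intro h
    exact hy0 (funext (Fintype.linearIndependent_iff.1 he y h))
  · rw [← hy]
    simp only [map_sum, LinearMap.sum_apply, map_smul, LinearMap.smul_apply, LinearMap.map_smulₛₗ,
      smul_eq_mul, Finset.mul_sum, mul_assoc]
    rw [Finset.sum_comm]
    refine Finset.sum_congr rfl fun i _ => Finset.sum_congr rfl fun j _ => ?_
    ring
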